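/- Let ε > 0. There is a constant C(ε) such that for every prime power q = p^k and all integers a, a′, b, b′, one has |Σ′_{X,X′=1}^{q} e((aX − a′X′)/q) · c_q(bX − b′X′)| ≤ C(ε) · q^{1+ε} · gcd(q, b, b′) · Σ_{f | gcd(q, ab′ − a′b)} f. -/

import Mathlib

open scoped BigOperators

/-- `e(t) = exp(2πit)` -/
noncomputable def e (t : ℝ) : ℂ := Complex.exp (2 * Real.pi * Complex.I * t)

/-- Ramanujan's sum `c_q(n) = Σ′_{a=1}^{q} e(an/q)` -/
noncomputable def ramanujanSum (q : ℕ) (n : ℤ) : ℂ :=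
  ∑ a ∈ (Finset.Icc 1 q).filter (fun a => Nat.Coprime a q), e ((((a : ℤ) * n : ℤ) : ℝ) / q)

/-- `𝒮 = Σ′_{X,X′=1}^{q} e((aX − a′X′)/q) · c_q(bX − b′X′)` -/
noncomputable def Ssum (q : ℕ) (a a' b b' : ℤ) : ℂ :=
  ∑ X ∈ (Finset.Icc 1 q).filter (fun X => Nat.Coprime X q),
    ∑ X' ∈ (Finset.Icc 1 q).filter (fun X' => Nat.Coprime X' q),
      e (((a * X - a' * X' : ℤ) : ℝ) / q) * ramanujanSum q (b * X - b' * X')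

lemma e_add (x y : ℝ) : e (x + y) = e x * e y := by
  simp only [e, ← Complex.exp_add]
  push_cast
  ring_nf

lemma norm_e (x : ℝ) : ‖e x‖ = 1 := by
  rw [e, show 2 * (Real.pi : ℂ) * Complex.I * x = ((2 * Real.pi * x : ℝ) : ℂ) * Complex.I by
    push_cast; ring]
  exact Complex.norm_exp_ofReal_mul_I _

lemma e_natCast_mul (n : ℕ) (x : ℝ) : e (n * x) = e x ^ n := by
  rw [e, e, ← Complex.exp_nat_mul]
  push_cast
  ring_nf

lemma e_intCast (n : ℤ) : e n = 1 := by
  rw [e, Complex.exp_eq_one_iff]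
  exact ⟨n, by push_cast; ring⟩

lemma dvd_of_e_div_eq_one {q : ℕ} (hq : 0 < q) {n : ℤ} (h : e ((n : ℝ) / q) = 1) :
    (q : ℤ) ∣ n := by
  rw [e, Complex.exp_eq_one_iff] at h
  obtain ⟨m, hm⟩ := h
  have hq' : (q : ℂ) ≠ 0 := by exact_mod_cast hq.ne'
  have h2 : (2 * (Real.pi : ℂ) * Complex.I) ≠ 0 := Complex.two_pi_I_ne_zero
  have h3 : ((n : ℂ) / q) = m := by
    apply mul_left_cancel₀ h2
    push_cast at hm
    rw [hm]
    ring
  rw [div_eq_iff hq'] at h3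
  exact ⟨m, by rw [mul_comm]; exact_mod_cast h3⟩

/-- Orthogonality of additive characters modulo `q`, as an upper bound. -/
lemma norm_sum_e_le {q : ℕ} (hq : 0 < q) (n : ℤ) :
    ‖∑ a ∈ Finset.Icc 1 q, e ((((a : ℤ) * n : ℤ) : ℝ) / q)‖ ≤
      if (q : ℤ) ∣ n then (q : ℝ) else 0 := by
  split_ifs with h
  · refine (norm_sum_le _ _).trans ?_
    simp [norm_e]
  · have hz : e ((n : ℝ) / q) ≠ 1 := fun hz => h (dvd_of_e_div_eq_one hq hz)
    have hq' : (q : ℝ) ≠ 0 := by exact_mod_cast hq.ne'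
    have hzq : e ((n : ℝ) / q) ^ q = 1 := by
      rw [← e_natCast_mul, mul_div_cancel₀ _ hq', e_intCast]
    have hsum : ∑ a ∈ Finset.Icc 1 q, e ((((a : ℤ) * n : ℤ) : ℝ) / q) =
        e ((n : ℝ) / q) * ∑ i ∈ Finset.range q, e ((n : ℝ) / q) ^ i := by
      rw [← Finset.Ico_add_one_right_eq_Icc, Finset.sum_Ico_eq_sum_range, Finset.mul_sum]
      refine Finset.sum_congr (by simp) fun i _ => ?_
      rw [← pow_succ', ← e_natCast_mul]
      congr 1
      push_cast
      ring
    rw [hsum, geom_sum_eq hz, hzq]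
    simp

lemma norm_ramanujanSum_le {p k q r : ℕ} (hp : p.Prime) (hr : r = p ^ k) (hq : q = p * r)
    (n : ℤ) :
    ‖ramanujanSum q n‖ ≤
      (if (q : ℤ) ∣ n then (q : ℝ) else 0) + if (r : ℤ) ∣ n then (r : ℝ) else 0 := by
  have hr0 : 0 < r := hr ▸ pow_pos hp.pos k
  have hq0 : 0 < q := hq ▸ mul_pos hp.pos hr0
  have hcop (a : ℕ) : Nat.Coprime a q ↔ ¬ p ∣ a := by
    rw [hq, hr, ← pow_succ', Nat.coprime_pow_right_iff (Nat.succ_pos k), Nat.coprime_comm,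
      hp.coprime_iff_not_dvd]
  have hmul : ∑ a ∈ (Finset.Icc 1 q).filter (fun a => ¬ Nat.Coprime a q),
      e ((((a : ℤ) * n : ℤ) : ℝ) / q) =
      ∑ a ∈ Finset.Icc 1 r, e ((((a : ℤ) * n : ℤ) : ℝ) / r) := by
    symm
    refine Finset.sum_bij (fun a _ => p * a) ?_ ?_ ?_ ?_
    · intro a ha
      simp only [Finset.mem_Icc, Finset.mem_filter, hcop, not_not] at ha ⊢
      exact ⟨⟨Nat.mul_pos hp.pos ha.1, hq ▸ Nat.mul_le_mul_left p ha.2⟩, dvd_mul_right _ _⟩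
    · intro a _ b _ h
      exact Nat.eq_of_mul_eq_mul_left hp.pos h
    · intro b hb
      simp only [Finset.mem_Icc, Finset.mem_filter, hcop, not_not] at hb
      obtain ⟨⟨h1, h2⟩, a, rfl⟩ := hb
      refine ⟨a, Finset.mem_Icc.2 ⟨Nat.pos_of_mul_pos_left h1, ?_⟩, rfl⟩
      exact Nat.le_of_mul_le_mul_left (hq ▸ h2) hp.pos
    · intro a _
      have hp' : (p : ℝ) ≠ 0 := by exact_mod_cast hp.ne_zero
      have hr' : (r : ℝ) ≠ 0 := by exact_mod_cast hr0.ne'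
      congr 1
      rw [hq]
      push_cast
      field_simp
  have hsplit := Finset.sum_filter_add_sum_filter_not (Finset.Icc 1 q)
    (fun a => Nat.Coprime a q) (fun a : ℕ => e ((((a : ℤ) * n : ℤ) : ℝ) / q))
  rw [hmul] at hsplit
  rw [ramanujanSum, eq_sub_of_add_eq hsplit]
  exact (norm_sub_le _ _).trans (add_le_add (norm_sum_e_le hq0 n) (norm_sum_e_le hr0 n))

lemma Ssum_eq_sum_ramanujanSum_mul (q : ℕ) (a a' b b' : ℤ) :
    Ssum q a a' b b' = ∑ Y ∈ (Finset.Icc 1 q).filter (fun Y => Nat.Coprime Y q),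
      ramanujanSum q (a + b * Y) * ramanujanSum q (-(a' + b' * Y)) := by
  simp only [Ssum, ramanujanSum, Finset.mul_sum, Finset.sum_mul]
  conv_rhs => rw [Finset.sum_comm]
  rw [Finset.sum_comm]
  refine Finset.sum_congr rfl fun X' _ => ?_
  rw [Finset.sum_comm]
  refine Finset.sum_congr rfl fun Y _ => Finset.sum_congr rfl fun X _ => ?_
  rw [← e_add, ← e_add]
  congr 1
  push_cast
  ring

/-- A subset of `{1, …, q}` all of whose differences are killed by `g` modulo `d ∣ q` has at most
`q g / d` elements. -/
lemma card_mul_le_of_dvd_mul_sub {q d g : ℕ} (hd : d ∣ q) (hq : 0 < q) (hg : 0 < g)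
    (s : Finset ℕ) (hs : s ⊆ Finset.Icc 1 q)
    (h : ∀ Y ∈ s, ∀ Z ∈ s, (d : ℤ) ∣ g * ((Y : ℤ) - Z)) : s.card * d ≤ q * g := by
  obtain ⟨m, hm⟩ := Nat.gcd_dvd_left d g
  have hd0 : 0 < d := Nat.pos_of_dvd_of_pos hd hq
  have hG : 0 < d.gcd g := Nat.gcd_pos_of_pos_left _ hd0
  have hm0 : 0 < m := Nat.pos_of_ne_zero fun h0 => by simp [h0] at hm; omega
  have hmd : m ∣ d := ⟨_, by rw [mul_comm]; exact hm⟩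
  have hmdvd : ∀ Y ∈ s, ∀ Z ∈ s, (m : ℤ) ∣ (Y : ℤ) - Z := by
    intro Y hY Z hZ
    have h1 : (d : ℤ) ∣ ((d.gcd g : ℕ) : ℤ) * ((Y : ℤ) - Z) := by
      rw [← Int.gcd_natCast_natCast, Int.gcd_eq_gcd_ab, add_mul]
      refine dvd_add ?_ ?_
      · exact (dvd_mul_right _ _).mul_right _
      · rw [mul_right_comm]
        exact (h Y hY Z hZ).mul_right _
    have h2 : ((d.gcd g : ℕ) : ℤ) * m ∣ ((d.gcd g : ℕ) : ℤ) * ((Y : ℤ) - Z) := by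
      rw [← Nat.cast_mul, ← hm]
      exact h1
    exact Int.dvd_of_mul_dvd_mul_left (by exact_mod_cast hG.ne') h2
  obtain ⟨t, ht⟩ := hmd.trans hd
  have hcard : s.card ≤ t := by
    rw [← Finset.card_range t]
    refine Finset.card_le_card_of_injOn (fun Y => (Y - 1) / m) ?_ ?_
    · intro Y hY
      have := Finset.mem_Icc.1 (hs hY)
      simp only [Finset.coe_range, Set.mem_Iio]
      rw [Nat.div_lt_iff_lt_mul hm0, mul_comm, ← ht]
      omega
    · intro Y hY Z hZ hYZ
      have hY1 := Finset.mem_Icc.1 (hs hY)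
      have hZ1 := Finset.mem_Icc.1 (hs hZ)
      have hmod : (Y - 1) % m = (Z - 1) % m := by
        refine ((Nat.modEq_iff_dvd).2 ?_ : (Y - 1) ≡ (Z - 1) [MOD m])
        have := hmdvd Z hZ Y hY
        push_cast [hY1.1, hZ1.1]
        simpa using this
      have h1 := Nat.div_add_mod (Y - 1) m
      have h2 := Nat.div_add_mod (Z - 1) m
      simp only at hYZ
      rw [hYZ, hmod, h2] at h1
      omega
  calc s.card * d ≤ t * d := Nat.mul_le_mul_right _ hcard
    _ = q * d.gcd g := by rw [ht]; conv_lhs => rw [hm]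
                          ring
    _ ≤ q * g := Nat.mul_le_mul_left _ (Nat.gcd_le_right _ hg)

/-- The solutions in `{1, …, q}` of a pair of linear divisibility conditions. -/
def linearSolutions (q d d' : ℕ) (a a' b b' : ℤ) : Finset ℕ :=
  (Finset.Icc 1 q).filter (fun Y => (d : ℤ) ∣ a + b * Y ∧ (d' : ℤ) ∣ a' + b' * Y)

lemma linearSolutions_comm (q d d' : ℕ) (a a' b b' : ℤ) :
    linearSolutions q d d' a a' b b' = linearSolutions q d' d a' a b' b := by
  simp only [linearSolutions, and_comm]

lemma gcd_swap_determinant (q : ℕ) (a a' b b' : ℤ) :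
    Int.gcd q (a' * b - a * b') = Int.gcd q (a * b' - a' * b) := by
  rw [← neg_sub, Int.gcd_neg]

lemma dvd_mul_sub_of_dvd {d a b Y Z : ℤ} (hY : d ∣ a + b * Y) (hZ : d ∣ a + b * Z) :
    d ∣ b * (Y - Z) := by
  have hsub := dvd_sub hY hZ
  rwa [show a + b * Y - (a + b * Z) = b * (Y - Z) by ring] at hsub

lemma dvd_gcd_mul_of_dvd {d b b' x : ℤ} {q : ℕ} (hq : d ∣ q) (h : d ∣ b * x) (h' : d ∣ b' * x) :
    d ∣ (Nat.gcd q (Int.gcd b b') : ℤ) * x := by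
  rw [← Int.gcd_natCast_natCast, Int.gcd_eq_gcd_ab, Int.gcd_eq_gcd_ab, add_mul]
  refine dvd_add ((hq.mul_right _).mul_right _) ?_
  rw [mul_right_comm, add_mul, mul_right_comm, mul_right_comm b']
  exact (dvd_add (h.mul_right _) (h'.mul_right _)).mul_right _

lemma dvd_determinant {d a a' b b' Y : ℤ} (h : d ∣ a + b * Y) (h' : d ∣ a' + b' * Y) :
    d ∣ a * b' - a' * b := by
  have hsub := dvd_sub (h.mul_right b') (h'.mul_right b)
  rwa [show (a + b * Y) * b' - (a' + b' * Y) * b = a * b' - a' * b by ring] at hsub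

lemma card_linearSolutions_mul_le {q d d' : ℕ} (hq : 0 < q) (hd : d ∣ q) (hd' : d' ∣ d)
    (a a' b b' : ℤ) :
    (linearSolutions q d d' a a' b b').card * d' ≤ q * Nat.gcd q (Int.gcd b b') := by
  refine card_mul_le_of_dvd_mul_sub (hd'.trans hd) hq (Nat.gcd_pos_of_pos_left _ hq) _
    (Finset.filter_subset _ _) fun Y hY Z hZ => ?_
  have hY := (Finset.mem_filter.1 hY).2
  have hZ := (Finset.mem_filter.1 hZ).2
  have hdd : (d' : ℤ) ∣ d := by exact_mod_cast hd'
  exact dvd_gcd_mul_of_dvd (by exact_mod_cast hd'.trans hd)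
    (hdd.trans (dvd_mul_sub_of_dvd hY.1 hZ.1)) (dvd_mul_sub_of_dvd hY.2 hZ.2)

lemma card_linearSolutions_mul_mul_le_of_dvd {q d d' : ℕ} (hq : 0 < q) (hd : d ∣ q) (hd' : d' ∣ d)
    (a a' b b' : ℤ) (hD : (d : ℤ) ∣ a * b' - a' * b) :
    (linearSolutions q d d' a a' b b').card * (d * d') ≤
      q * Nat.gcd q (Int.gcd b b') * Int.gcd q (a * b' - a' * b) := by
  have hdvd : d ∣ Int.gcd q (a * b' - a' * b) :=
    Int.dvd_gcd (by exact_mod_cast hd) hD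
  have hle := Nat.le_of_dvd (Int.gcd_pos_of_ne_zero_left _ (by exact_mod_cast hq.ne')) hdvd
  calc _ = (linearSolutions q d d' a a' b b').card * d' * d := by ring
    _ ≤ _ := Nat.mul_le_mul (card_linearSolutions_mul_le hq hd hd' a a' b b') hle

lemma card_linearSolutions_self_mul_mul_le {q d : ℕ} (hq : 0 < q) (hd : d ∣ q) (a a' b b' : ℤ) :
    (linearSolutions q d d a a' b b').card * (d * d) ≤
      q * Nat.gcd q (Int.gcd b b') * Int.gcd q (a * b' - a' * b) := by
  rcases (linearSolutions q d d a a' b b').eq_empty_or_nonempty with h | ⟨Y, hY⟩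
  · simp [h]
  · have hY := (Finset.mem_filter.1 hY).2
    exact card_linearSolutions_mul_mul_le_of_dvd hq hd dvd_rfl a a' b b'
      (dvd_determinant hY.1 hY.2)

lemma card_linearSolutions_mixed_mul_mul_le {p k q r : ℕ} (hp : p.Prime) (hr : r = p ^ k)
    (hq : q = p * r) (a a' b b' : ℤ) :
    (linearSolutions q q r a a' b b').card * (q * r) ≤
      q * Nat.gcd q (Int.gcd b b') * Int.gcd q (a * b' - a' * b) := by
  have hr0 : 0 < r := hr ▸ pow_pos hp.pos k
  have hq0 : 0 < q := hq ▸ mul_pos hp.pos hr0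
  have hrq : r ∣ q := ⟨p, by rw [hq, mul_comm]⟩
  have hrq' : (r : ℤ) ∣ q := by exact_mod_cast hrq
  by_cases hD : (q : ℤ) ∣ a * b' - a' * b
  · exact card_linearSolutions_mul_mul_le_of_dvd hq0 dvd_rfl hrq a a' b b' hD
  rcases (linearSolutions q q r a a' b b').eq_empty_or_nonempty with h | ⟨Y, hY⟩
  · simp [h]
  have hY := (Finset.mem_filter.1 hY).2
  have hrD : (r : ℤ) ∣ a * b' - a' * b := dvd_determinant (hrq'.trans hY.1) hY.2
  have hle : r ≤ Int.gcd q (a * b' - a' * b) :=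
    Nat.le_of_dvd (Int.gcd_pos_of_ne_zero_left _ (by exact_mod_cast hq0.ne'))
      (Int.dvd_gcd hrq' hrD)
  have hpb : ¬ (p : ℤ) ∣ b := by
    intro hpb
    apply hD
    have h1 : (q : ℤ) ∣ (a' + b' * Y) * b := by
      rw [hq, Nat.cast_mul, mul_comm (p : ℤ)]
      exact mul_dvd_mul hY.2 hpb
    have hsub := dvd_sub (hY.1.mul_right b') h1
    rwa [show (a + b * Y) * b' - (a' + b' * Y) * b = a * b' - a' * b by ring] at hsub
  have hcop : IsCoprime (q : ℤ) b := by
    rw [hq, hr, ← pow_succ', Nat.cast_pow]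
    exact ((Nat.prime_iff_prime_int.1 hp).coprime_iff_not_dvd.2 hpb).pow_left
  have hcard : (linearSolutions q q r a a' b b').card * q ≤ q * 1 := by
    refine card_mul_le_of_dvd_mul_sub dvd_rfl hq0 one_pos _ (Finset.filter_subset _ _)
      fun Z hZ W hW => ?_
    have hZ := (Finset.mem_filter.1 hZ).2
    have hW := (Finset.mem_filter.1 hW).2
    simpa using hcop.dvd_of_dvd_mul_left (dvd_mul_sub_of_dvd hZ.1 hW.1)
  calc _ = (linearSolutions q q r a a' b b').card * q * r := by ring
    _ ≤ q * Nat.gcd q (Int.gcd b b') * Int.gcd q (a * b' - a' * b) :=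
      Nat.mul_le_mul (hcard.trans (Nat.mul_le_mul_left _ (Nat.gcd_pos_of_pos_left _ hq0))) hle

lemma sum_ite_dvd_mul_ite_dvd (q d d' : ℕ) (a a' b b' : ℤ) :
    ∑ Y ∈ Finset.Icc 1 q, (if (d : ℤ) ∣ a + b * (Y : ℕ) then (d : ℝ) else 0) *
      (if (d' : ℤ) ∣ a' + b' * (Y : ℕ) then (d' : ℝ) else 0) =
    (((linearSolutions q d d' a a' b b').card * (d * d') : ℕ) : ℝ) := by
  simp only [ite_zero_mul_ite_zero]
  rw [← Finset.sum_filter, Finset.sum_const, nsmul_eq_mul, linearSolutions]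
  push_cast
  ring

lemma norm_Ssum_le {p k q r : ℕ} (hp : p.Prime) (hr : r = p ^ k) (hq : q = p * r)
    (a a' b b' : ℤ) :
    ‖Ssum q a a' b b'‖ ≤
      4 * q * Nat.gcd q (Int.gcd b b') * Int.gcd q (a * b' - a' * b) := by
  have hr0 : 0 < r := hr ▸ pow_pos hp.pos k
  have hq0 : 0 < q := hq ▸ mul_pos hp.pos hr0
  have hrq : r ∣ q := ⟨p, by rw [hq, mul_comm]⟩
  let w (d : ℕ) (n : ℤ) : ℝ := if (d : ℤ) ∣ n then (d : ℝ) else 0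
  have hw (d : ℕ) (n : ℤ) : 0 ≤ w d n := by
    simp only [w]
    split_ifs <;> positivity
  have hc (n : ℤ) : ‖ramanujanSum q n‖ ≤ w q n + w r n := norm_ramanujanSum_le hp hr hq n
  have hneg (d : ℕ) (n : ℤ) : w d (-n) = w d n := by simp [w]
  have hN (d d' : ℕ) : ∑ Y ∈ Finset.Icc 1 q, w d (a + b * (Y : ℕ)) * w d' (a' + b' * (Y : ℕ)) =
      (((linearSolutions q d d' a a' b b').card * (d * d') : ℕ) : ℝ) :=
    sum_ite_dvd_mul_ite_dvd q d d' a a' b b'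
  have h1 := card_linearSolutions_self_mul_mul_le hq0 dvd_rfl a a' b b'
  have h2 := card_linearSolutions_self_mul_mul_le hq0 hrq a a' b b'
  have h3 := card_linearSolutions_mixed_mul_mul_le hp hr hq a a' b b'
  have h4 := card_linearSolutions_mixed_mul_mul_le hp hr hq a' a b' b
  rw [← linearSolutions_comm, gcd_swap_determinant, Int.gcd_comm b' b, mul_comm q r] at h4
  calc ‖Ssum q a a' b b'‖
      ≤ ∑ Y ∈ (Finset.Icc 1 q).filter (fun Y => Nat.Coprime Y q),
          (w q (a + b * (Y : ℕ)) + w r (a + b * (Y : ℕ))) *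
            (w q (a' + b' * (Y : ℕ)) + w r (a' + b' * (Y : ℕ))) := by
        rw [Ssum_eq_sum_ramanujanSum_mul]
        refine norm_sum_le_of_le _ fun Y _ => ?_
        rw [norm_mul]
        refine mul_le_mul (hc _) ?_ (norm_nonneg _) (add_nonneg (hw _ _) (hw _ _))
        simpa only [hneg] using hc (-(a' + b' * Y))
    _ ≤ ∑ Y ∈ Finset.Icc 1 q, (w q (a + b * (Y : ℕ)) + w r (a + b * (Y : ℕ))) *
            (w q (a' + b' * (Y : ℕ)) + w r (a' + b' * (Y : ℕ))) :=
        Finset.sum_le_sum_of_subset_of_nonneg (Finset.filter_subset _ _) fun Y _ _ =>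
          mul_nonneg (add_nonneg (hw _ _) (hw _ _)) (add_nonneg (hw _ _) (hw _ _))
    _ = (((linearSolutions q q q a a' b b').card * (q * q) +
          (linearSolutions q q r a a' b b').card * (q * r) +
          ((linearSolutions q r q a a' b b').card * (r * q) +
          (linearSolutions q r r a a' b b').card * (r * r)) : ℕ) : ℝ) := by
        rw [Nat.cast_add, Nat.cast_add, Nat.cast_add, ← hN, ← hN, ← hN, ← hN]
        simp only [add_mul, mul_add, Finset.sum_add_distrib]
        ring
    _ ≤ ((4 * (q * Nat.gcd q (Int.gcd b b') * Int.gcd q (a * b' - a' * b)) : ℕ) : ℝ) := by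
        exact_mod_cast (by omega)
    _ = _ := by push_cast; ring

lemma norm_Ssum_one (a a' b b' : ℤ) : ‖Ssum 1 a a' b b'‖ = 1 := by
  simp [Ssum, ramanujanSum, norm_e]

/-- For every `ε > 0` there is `C = C(ε)` such that for every prime power
`q = p^k` and all integers `a, a′, b, b′`:
`|𝒮| ≤ C · q^{1+ε} · gcd(q,b,b′) · Σ_{f ∣ gcd(q, ab′−a′b)} f`. -/
theorem stmt8 :
    ∀ ε : ℝ, 0 < ε → ∃ C : ℝ, 0 < C ∧
      ∀ p : ℕ, p.Prime → ∀ k : ℕ, ∀ q : ℕ, q = p ^ k → ∀ a a' b b' : ℤ,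
        ‖Ssum q a a' b b'‖ ≤
          C * (q : ℝ) ^ ((1 : ℝ) + ε) * (Nat.gcd q (Int.gcd b b') : ℝ) *
            ∑ f ∈ (Int.gcd (q : ℤ) (a * b' - a' * b)).divisors, (f : ℝ) := by
  intro ε hε
  refine ⟨4, by norm_num, ?_⟩
  rintro p hp k q rfl a a' b b'
  have hq0 : 0 < p ^ k := pow_pos hp.pos k
  have hq1 : (1 : ℝ) ≤ ((p ^ k : ℕ) : ℝ) := by exact_mod_cast hq0
  have hS : ‖Ssum (p ^ k) a a' b b'‖ ≤ 4 * ((p ^ k : ℕ) : ℝ) *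
      Nat.gcd (p ^ k) (Int.gcd b b') * Int.gcd ((p ^ k : ℕ) : ℤ) (a * b' - a' * b) := by
    cases k with
    | zero => simp [norm_Ssum_one]
    | succ k => exact norm_Ssum_le hp rfl (pow_succ' p k) a a' b b'
  refine hS.trans ?_
  have hpow : ((p ^ k : ℕ) : ℝ) ≤ ((p ^ k : ℕ) : ℝ) ^ ((1 : ℝ) + ε) :=
    Real.self_le_rpow_of_one_le hq1 (by linarith)
  have hG : Int.gcd ((p ^ k : ℕ) : ℤ) (a * b' - a' * b) ≠ 0 :=
    (Int.gcd_pos_of_ne_zero_left _ (by exact_mod_cast hq0.ne')).ne'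
  have hdiv : (Int.gcd ((p ^ k : ℕ) : ℤ) (a * b' - a' * b) : ℝ) ≤
      ∑ f ∈ (Int.gcd ((p ^ k : ℕ) : ℤ) (a * b' - a' * b)).divisors, (f : ℝ) :=
    Finset.single_le_sum (f := fun f : ℕ => (f : ℝ)) (fun f _ => Nat.cast_nonneg f)
      (Nat.mem_divisors_self _ hG)
  gcongr
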